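/- Let N, k ∈ ℕ and let ξ ∈ ℓ²(F_∞^k) be a unit vector. Define the Gram-type matrix G_k(ξ), indexed by v,w ∈ {1,…,N}^k, with entries G_k(ξ)_{vw} = N^{-k}⟨U_w ξ, U_v ξ⟩. Then ‖G_k(ξ)‖₂ ≤ N^{-k/2} · (1 + √((1 + 9/N)^k − 1)). -/

import Mathlib

open scoped ENNReal

noncomputable section

/-- The free group on countably many generators. -/
abbrev FG : Type := FreeGroup ℕ

/-- The generators `g_i` of the free group. -/
def gen (i : ℕ) : FG := FreeGroup.of i

/-- `ℓ²(F_∞^k)`. -/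
abbrev l2 (k : ℕ) : Type := lp (fun _ : Fin k → FG => ℂ) 2

/-- The Hilbert–Schmidt (Frobenius) norm of a matrix. -/
def frobNorm {ι : Type*} [Fintype ι] (a : ι → ι → ℂ) : ℝ :=
  Real.sqrt (∑ v : ι, ∑ w : ι, ‖a v w‖ ^ 2)

/-- The inner product `⟨U_w ξ, U_v ξ⟩ = Σ_x conj((U_w ξ)(x)) (U_v ξ)(x)`, where
`(U_v ξ)(x) = ξ(g_{v_1}^{-1}x_1, …, g_{v_k}^{-1}x_k)`. -/
def innerUU {N k : ℕ} (ξ : l2 k) (w v : Fin k → Fin N) : ℂ :=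
  ∑' x : Fin k → FG,
    (starRingEnd ℂ) (ξ (fun j => (gen (w j : ℕ))⁻¹ * x j)) *
      ξ (fun j => (gen (v j : ℕ))⁻¹ * x j)

/-- The Gram-type matrix `G_k(ξ)_{vw} = N^{-k}⟨U_w ξ, U_v ξ⟩`, i.e. the output of the
complementary channel of `Φ_N^{⊗k}` at the pure state `|ξ⟩⟨ξ|`. -/
def Gmat (N k : ℕ) (ξ : l2 k) : Matrix (Fin k → Fin N) (Fin k → Fin N) ℂ :=
  Matrix.of fun v w => ((N : ℂ) ^ k)⁻¹ * innerUU ξ w v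

/-- The word of `g_a * y` is the word of `y` with `g_a` put in front, unless the word of `y`
starts with `g_a⁻¹`, which is then removed. -/
theorem toWord_gen_mul (a : ℕ) (y : FG) :
    (gen a * y).toWord = (a, true) :: y.toWord ∨
      y.toWord = (a, false) :: (gen a * y).toWord := by
  have h : (gen a * y).toWord = FreeGroup.reduce ((a, true) :: y.toWord) := by
    rw [FreeGroup.toWord_mul, gen, FreeGroup.toWord_of]; rfl
  rw [h, FreeGroup.reduce.cons, FreeGroup.reduce_toWord]
  rcases y.toWord with _ | ⟨⟨b, e⟩, L⟩
  · left; rfl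
  · by_cases hb : a = b <;> cases e <;> simp [hb]

/-- The class of `x` relative to `a ≠ b`: `0` if `x` starts with `g_a`, `1` if it starts with
`g_b`, and `2` otherwise. For `a = b` there is only the class `0`. -/
def prefixClass (a b : ℕ) (x : FG) : Fin 3 :=
  if a = b ∨ x.toWord.head? = some (a, true) then 0
  else if x.toWord.head? = some (b, true) then 1 else 2

/-- The number `1` or `3` of prefix classes relative to `a, b` if `g_a y` and `g_b z` lie in the
same class, and `0` otherwise. -/
def classWeight (a b : ℕ) (y z : FG) : ℕ :=
  (if a = b then 1 else 3) *
    if prefixClass a b (gen a * y) = prefixClass a b (gen b * z) then 1 else 0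

theorem head_tail_of_prefixClass_eq {a b : ℕ} (hab : a ≠ b) {y z : FG}
    (h : prefixClass a b (gen a * y) = prefixClass a b (gen b * z)) :
    [(b, false), (a, true)] <+: z.toWord ∨ [(a, false), (b, true)] <+: y.toWord ∨
      ([(a, false)] <+: y.toWord ∧ [(b, false)] <+: z.toWord) := by
  unfold prefixClass at h
  rcases toWord_gen_mul a y with hy | hy <;> rcases toWord_gen_mul b z with hz | hz
  · simp [hy, hz, hab, hab.symm] at h
  · left
    rcases hw : (gen b * z).toWord with _ | ⟨c, L⟩
    · simp [hy, hw, hab] at h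
    · by_cases hc : c = (a, true)
      · rw [hz, hw, hc]; exact ⟨L, rfl⟩
      · simp only [hy, hw, hab, List.head?_cons, false_or, Option.some.injEq, hc,
          if_true, if_false] at h
        split_ifs at h <;> simp at h
  · right; left
    rcases hw : (gen a * y).toWord with _ | ⟨c, L⟩
    · simp [hz, hw, hab, hab.symm] at h
    · by_cases hc : c = (b, true)
      · rw [hy, hw, hc]; exact ⟨L, rfl⟩
      · simp only [hz, hw, hab, List.head?_cons, false_or, Option.some.injEq, hc,
          Prod.mk.injEq, hab.symm, false_and, if_true, if_false] at h
        split_ifs at h <;> simp at h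
  · right; right
    exact ⟨⟨_, hy.symm⟩, ⟨_, hz.symm⟩⟩

theorem sum_classWeight_le (N : ℕ) (y z : FG) :
    ∑ p : Fin N × Fin N, classWeight (p.2 : ℕ) (p.1 : ℕ) y z ≤ N + 9 := by
  classical
  have hle : ∀ p : Fin N × Fin N, classWeight (p.2 : ℕ) (p.1 : ℕ) y z ≤
      (if p.1 = p.2 then 1 else 0) +
      3 * ((if [((p.1 : ℕ), false), ((p.2 : ℕ), true)] <+: z.toWord then 1 else 0) +
        (if [((p.2 : ℕ), false), ((p.1 : ℕ), true)] <+: y.toWord then 1 else 0) +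
        (if [((p.2 : ℕ), false)] <+: y.toWord ∧ [((p.1 : ℕ), false)] <+: z.toWord
          then 1 else 0)) := by
    rintro ⟨v, w⟩
    unfold classWeight
    by_cases hvw : v = w
    · subst hvw
      simp only [if_true, one_mul]
      split_ifs <;> omega
    · have hab : (w : ℕ) ≠ v := fun h => hvw (Fin.ext h.symm)
      simp only [hab, hvw, if_false, zero_add]
      by_cases h : prefixClass w v (gen w * y) = prefixClass w v (gen v * z)
      · rcases head_tail_of_prefixClass_eq hab h with h1 | h1 | h1 <;>
          simp only [h1, h, if_true, and_self] <;> split_ifs <;> omega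
      · simp [h]
  refine (Finset.sum_le_sum fun p _ => hle p).trans ?_
  rw [Finset.sum_add_distrib, ← Finset.mul_sum, Finset.sum_add_distrib, Finset.sum_add_distrib]
  have hdiag : ∑ p : Fin N × Fin N, (if p.1 = p.2 then 1 else 0) = N := by
    rw [Fintype.sum_prod_type]; simp
  have hone : ∀ (P : Fin N × Fin N → Prop) [DecidablePred P], (∀ p q, P p → P q → p = q) →
      ∑ p : Fin N × Fin N, (if P p then 1 else 0) ≤ 1 := by
    intro P _ hP
    rw [Finset.sum_boole]
    exact_mod_cast Finset.card_le_one.2 fun p hp q hq =>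
      hP p q (Finset.mem_filter.1 hp).2 (Finset.mem_filter.1 hq).2
  have key : ∀ {L₁ L₂ L : List (ℕ × Bool)}, L₁ <+: L → L₂ <+: L → L₁.length = L₂.length →
      L₁ = L₂ := fun h₁ h₂ h => (List.prefix_of_prefix_length_le h₁ h₂ h.le).eq_of_length h
  have h1 := hone (fun p => [((p.1 : ℕ), false), ((p.2 : ℕ), true)] <+: z.toWord) (by
    intro p q hp hq
    have := key hp hq rfl
    simp only [List.cons.injEq, Prod.mk.injEq, Fin.val_inj, and_true] at this
    exact Prod.ext this.1 this.2)
  have h2 := hone (fun p => [((p.2 : ℕ), false), ((p.1 : ℕ), true)] <+: y.toWord) (by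
    intro p q hp hq
    have := key hp hq rfl
    simp only [List.cons.injEq, Prod.mk.injEq, Fin.val_inj, and_true] at this
    exact Prod.ext this.2 this.1)
  have h3 := hone (fun p => [((p.2 : ℕ), false)] <+: y.toWord ∧
      [((p.1 : ℕ), false)] <+: z.toWord) (by
    intro p q hp hq
    have hy := key hp.1 hq.1 rfl
    have hz := key hp.2 hq.2 rfl
    simp only [List.cons.injEq, Prod.mk.injEq, Fin.val_inj, and_true] at hy hz
    exact Prod.ext hz hy)
  omega

/-- The Cauchy–Schwarz inequality for series in `ℝ≥0∞`. -/
theorem sq_tsum_mul_le_tsum_sq_mul_tsum_sq {X : Type*} (f g : X → ℝ≥0∞) :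
    (∑' x, f x * g x) ^ 2 ≤ (∑' x, f x ^ 2) * ∑' x, g x ^ 2 := by
  let : MeasurableSpace X := ⊤
  have h := ENNReal.lintegral_mul_le_Lp_mul_Lq
    (MeasureTheory.Measure.count : MeasureTheory.Measure X)
    Real.HolderConjugate.two_two (f := f) (g := g) measurable_from_top.aemeasurable
    measurable_from_top.aemeasurable
  simp only [Pi.mul_apply, MeasureTheory.lintegral_count' measurable_from_top,
    ENNReal.rpow_two] at h
  calc (∑' x, f x * g x) ^ 2
      ≤ ((∑' x, f x ^ 2) ^ (1 / 2 : ℝ) * (∑' x, g x ^ 2) ^ (1 / 2 : ℝ)) ^ 2 := by gcongr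
    _ = _ := by
      rw [mul_pow, ← ENNReal.rpow_two, ← ENNReal.rpow_two, ← ENNReal.rpow_mul,
        ← ENNReal.rpow_mul]
      norm_num

/-- Cauchy–Schwarz applied on each of finitely many classes and then to the sum over classes. -/
theorem sq_tsum_mul_le_card_mul {X ι : Type*} [DecidableEq ι] (t : X → ι) (T : Finset ι)
    (ht : ∀ x, t x ∈ T) (f g : X → ℝ≥0∞) :
    (∑' x, f x * g x) ^ 2 ≤
      (T.card : ℝ≥0∞) * ∑' x, ∑' x', if t x = t x' then f x ^ 2 * g x' ^ 2 else 0 := by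
  have hsplit : ∑' x, f x * g x =
      ∑ s ∈ T, ∑' x, (if t x = s then f x else 0) * (if t x = s then g x else 0) := by
    rw [← Summable.tsum_finsetSum fun _ _ => ENNReal.summable]
    refine tsum_congr fun x => ?_
    rw [Finset.sum_eq_single (t x)]
    · simp
    · intro s _ hs; simp [hs.symm]
    · intro h; exact absurd (ht x) h
  have hcard := ENNReal.rpow_sum_le_const_mul_sum_rpow T
    (fun s => ∑' x, (if t x = s then f x else 0) * (if t x = s then g x else 0))
    (p := 2) one_le_two
  have hexp : (2 : ℝ) - 1 = 1 := by norm_num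
  simp only [ENNReal.rpow_two, hexp, ENNReal.rpow_one] at hcard
  rw [hsplit]
  refine hcard.trans (mul_le_mul_right ((Finset.sum_le_sum fun s _ =>
    sq_tsum_mul_le_tsum_sq_mul_tsum_sq _ _).trans (le_of_eq ?_)) _)
  simp_rw [← ENNReal.tsum_mul_right, ← ENNReal.tsum_mul_left]
  rw [← Summable.tsum_finsetSum fun _ _ => ENNReal.summable]
  refine tsum_congr fun x => ?_
  rw [← Summable.tsum_finsetSum fun _ _ => ENNReal.summable]
  refine tsum_congr fun x' => ?_
  rw [Finset.sum_eq_single (t x)]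
  · by_cases h : t x = t x' <;> simp [h, eq_comm]
  · intro s _ hs; simp [hs.symm]
  · intro h; exact absurd (ht x) h

theorem enorm_innerUU_sq_le {N k : ℕ} (ξ : l2 k) (w v : Fin k → Fin N) :
    ‖innerUU ξ w v‖ₑ ^ 2 ≤ ∑' y, ∑' z, ‖ξ y‖ₑ ^ 2 * ‖ξ z‖ₑ ^ 2 *
      ((∏ j, classWeight (w j : ℕ) (v j : ℕ) (y j) (z j) : ℕ) : ℝ≥0∞) := by
  classical
  let t : (Fin k → FG) → Fin k → Fin 3 := fun x j => prefixClass (w j : ℕ) (v j : ℕ) (x j)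
  let T : Finset (Fin k → Fin 3) :=
    Fintype.piFinset fun j => if w j = v j then {0} else Finset.univ
  have ht : ∀ x, t x ∈ T := by
    intro x
    refine Fintype.mem_piFinset.2 fun j => ?_
    by_cases h : w j = v j <;> simp [t, h, prefixClass]
  have hT : T.card = ∏ j, if (w j : ℕ) = v j then 1 else 3 := by
    rw [Fintype.card_piFinset]
    refine Finset.prod_congr rfl fun j _ => ?_
    by_cases h : w j = v j <;> simp [h, Fin.val_inj]
  let e : (Fin k → Fin N) → (Fin k → FG) ≃ (Fin k → FG) := fun u =>
    Equiv.mulLeft fun j => gen (u j : ℕ)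
  have hsymm : ∀ u x, (e u).symm x = fun j => (gen (u j : ℕ))⁻¹ * x j := fun _ _ => rfl
  calc ‖innerUU ξ w v‖ₑ ^ 2
      ≤ (∑' x, ‖ξ ((e w).symm x)‖ₑ * ‖ξ ((e v).symm x)‖ₑ) ^ 2 := by
        gcongr
        refine enorm_tsum_le_tsum_enorm.trans (le_of_eq (tsum_congr fun x => ?_))
        rw [enorm_mul, hsymm, hsymm, RCLike.enorm_conj]
    _ ≤ _ := sq_tsum_mul_le_card_mul t T ht _ _
    _ = (T.card : ℝ≥0∞) * ∑' y, ∑' z,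
          if t (e w y) = t (e v z) then ‖ξ y‖ₑ ^ 2 * ‖ξ z‖ₑ ^ 2 else 0 := by
        congr 1
        rw [← (e w).tsum_eq]
        refine tsum_congr fun y => ?_
        rw [← (e v).tsum_eq]
        simp only [Equiv.symm_apply_apply]
    _ = _ := by
        simp_rw [← ENNReal.tsum_mul_left]
        refine tsum_congr fun y => tsum_congr fun z => ?_
        have hw : (∏ j, classWeight (w j : ℕ) (v j : ℕ) (y j) (z j)) =
            T.card * if t (e w y) = t (e v z) then 1 else 0 := by
          simp only [classWeight, Finset.prod_mul_distrib, hT]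
          congr 1
          rw [Finset.prod_ite_zero]
          simp [funext_iff, t, e]
        rw [hw]
        split_ifs <;> simp [mul_comm]

theorem sum_enorm_innerUU_sq_le (N k : ℕ) (ξ : l2 k) :
    ∑ v : Fin k → Fin N, ∑ w : Fin k → Fin N, ‖innerUU ξ w v‖ₑ ^ 2 ≤
      (∑' y, ‖ξ y‖ₑ ^ 2) ^ 2 * ((N + 9 : ℕ) : ℝ≥0∞) ^ k := by
  classical
  have hprod : ∀ y z : Fin k → FG, ∑ v : Fin k → Fin N, ∑ w : Fin k → Fin N,
      ∏ j, classWeight (w j : ℕ) (v j : ℕ) (y j) (z j) ≤ (N + 9) ^ k := by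
    intro y z
    rw [← Fintype.sum_prod_type',
      ← (Equiv.arrowProdEquivProdArrow (Fin k) (fun _ => Fin N) (fun _ => Fin N)).sum_comp]
    refine (Fintype.prod_sum fun j (p : Fin N × Fin N) =>
      classWeight (p.2 : ℕ) (p.1 : ℕ) (y j) (z j)).symm.trans_le ?_
    exact (Finset.prod_le_prod' fun j _ => sum_classWeight_le N (y j) (z j)).trans (by simp)
  calc ∑ v : Fin k → Fin N, ∑ w : Fin k → Fin N, ‖innerUU ξ w v‖ₑ ^ 2
      ≤ ∑ v : Fin k → Fin N, ∑ w : Fin k → Fin N, ∑' y, ∑' z, ‖ξ y‖ₑ ^ 2 * ‖ξ z‖ₑ ^ 2 *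
          ((∏ j, classWeight (w j : ℕ) (v j : ℕ) (y j) (z j) : ℕ) : ℝ≥0∞) :=
        Finset.sum_le_sum fun v _ => Finset.sum_le_sum fun w _ => enorm_innerUU_sq_le ξ w v
    _ = ∑' y, ∑' z, ‖ξ y‖ₑ ^ 2 * ‖ξ z‖ₑ ^ 2 *
          ((∑ v : Fin k → Fin N, ∑ w : Fin k → Fin N,
            ∏ j, classWeight (w j : ℕ) (v j : ℕ) (y j) (z j) : ℕ) : ℝ≥0∞) := by
        simp_rw [← Summable.tsum_finsetSum fun _ _ => ENNReal.summable, ← Finset.mul_sum]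
        norm_cast
    _ ≤ ∑' y, ∑' z, ‖ξ y‖ₑ ^ 2 * ‖ξ z‖ₑ ^ 2 * ((N + 9 : ℕ) : ℝ≥0∞) ^ k := by
        refine ENNReal.tsum_le_tsum fun y => ENNReal.tsum_le_tsum fun z => ?_
        gcongr
        exact_mod_cast hprod y z
    _ = _ := by
        simp_rw [ENNReal.tsum_mul_right, ENNReal.tsum_mul_left, ENNReal.tsum_mul_right, sq]

theorem tsum_enorm_sq_eq_one {k : ℕ} {ξ : l2 k} (hξ : ‖ξ‖ = 1) : ∑' y, ‖ξ y‖ₑ ^ 2 = 1 := by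
  have h := lp.hasSum_norm (p := 2) (by norm_num) ξ
  simp only [hξ, ENNReal.toReal_ofNat, Real.rpow_two, one_pow] at h
  have h' := ENNReal.ofReal_tsum_of_nonneg (fun y => sq_nonneg ‖ξ y‖) h.summable
  rw [h.tsum_eq, ENNReal.ofReal_one] at h'
  rw [h']
  refine tsum_congr fun y => ?_
  rw [ENNReal.ofReal_pow (norm_nonneg _), ofReal_norm]

theorem sum_norm_innerUU_sq_le (N k : ℕ) {ξ : l2 k} (hξ : ‖ξ‖ = 1) :
    ∑ v : Fin k → Fin N, ∑ w : Fin k → Fin N, ‖innerUU ξ w v‖ ^ 2 ≤ ((N : ℝ) + 9) ^ k := by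
  have h := sum_enorm_innerUU_sq_le N k ξ
  rw [tsum_enorm_sq_eq_one hξ, one_pow, one_mul] at h
  have hne : ((N + 9 : ℕ) : ℝ≥0∞) ^ k ≠ ⊤ := ENNReal.pow_ne_top (ENNReal.natCast_ne_top _)
  have h' := ENNReal.toReal_mono hne h
  rw [ENNReal.toReal_pow, ENNReal.toReal_natCast,
    ENNReal.toReal_sum (by simp [ENNReal.sum_eq_top])] at h'
  refine le_trans (le_of_eq (Finset.sum_congr rfl fun v _ => ?_)) (h'.trans (by push_cast; rfl))
  rw [ENNReal.toReal_sum (by simp)]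
  simp

/-- For every unit vector `ξ ∈ ℓ²(F_∞^k)`, the Gram-type matrix `G_k(ξ)` satisfies
`‖G_k(ξ)‖₂ ≤ N^{-k/2}(1 + √((1+9/N)^k − 1))`. -/
theorem frobNorm_Gmat_le (N k : ℕ) (ξ : l2 k) (hξ : ‖ξ‖ = 1) :
    frobNorm (fun v w : Fin k → Fin N => Gmat N k ξ v w)
      ≤ (1 + Real.sqrt ((1 + 9 / (N : ℝ)) ^ k - 1)) / (N : ℝ) ^ ((k : ℝ) / 2) := by
  have hsum : ∑ v : Fin k → Fin N, ∑ w : Fin k → Fin N, ‖Gmat N k ξ v w‖ ^ 2 =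
      (((N : ℝ) ^ k)⁻¹) ^ 2 *
        ∑ v : Fin k → Fin N, ∑ w : Fin k → Fin N, ‖innerUU ξ w v‖ ^ 2 := by
    simp_rw [Finset.mul_sum]
    simp [Gmat, mul_pow]
  have hbound : ∑ v : Fin k → Fin N, ∑ w : Fin k → Fin N, ‖Gmat N k ξ v w‖ ^ 2 ≤
      (1 + 9 / (N : ℝ)) ^ k / (N : ℝ) ^ k := by
    rw [hsum]
    refine (mul_le_mul_of_nonneg_left (sum_norm_innerUU_sq_le N k hξ) (by positivity)).trans ?_
    rcases Nat.eq_zero_or_pos N with rfl | hN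
    · rcases Nat.eq_zero_or_pos k with rfl | hk
      · simp
      · simp [hk.ne']
    · have hN' : (N : ℝ) ≠ 0 := by positivity
      apply le_of_eq
      rw [one_add_div hN', div_pow]
      field_simp
  have hone : 1 ≤ (1 + 9 / (N : ℝ)) ^ k := one_le_pow₀ (by simp; positivity)
  have hsqrt : Real.sqrt ((1 + 9 / (N : ℝ)) ^ k) ≤
      1 + Real.sqrt ((1 + 9 / (N : ℝ)) ^ k - 1) := by
    rw [Real.sqrt_le_left (by positivity)]
    nlinarith [Real.sq_sqrt (sub_nonneg.2 hone), Real.sqrt_nonneg ((1 + 9 / (N : ℝ)) ^ k - 1)]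
  have hpow : Real.sqrt ((N : ℝ) ^ k) = (N : ℝ) ^ ((k : ℝ) / 2) := by
    rw [Real.sqrt_eq_rpow, ← Real.rpow_natCast, ← Real.rpow_mul (by positivity)]
    congr 1; ring
  calc frobNorm (fun v w : Fin k → Fin N => Gmat N k ξ v w)
      ≤ Real.sqrt ((1 + 9 / (N : ℝ)) ^ k / (N : ℝ) ^ k) := Real.sqrt_le_sqrt hbound
    _ = Real.sqrt ((1 + 9 / (N : ℝ)) ^ k) / (N : ℝ) ^ ((k : ℝ) / 2) := by
      rw [Real.sqrt_div (by positivity), hpow]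
    _ ≤ _ := by gcongr
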